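/- arXiv:math/0404418 — 4 statements merged into one kernel-verified Lean document; each statement's English description precedes it below -/
import Mathlib

section
/- As t tends to π/2 from the left, ξ(t) tends to 0 and ξ'(t) tends to 2π/3; as t tends to −π/2 from the right, ξ(t) tends to 0 and ξ'(t) tends to −2π/3. -/
open Real Set Filter Topology

noncomputable def xi (t : ℝ) : ℝ :=
  (Real.cos t ^ 2 + 2 * t * Real.sin t * Real.cos t + t ^ 2 - Real.pi ^ 2 / 4) / Real.cos t ^ 2

noncomputable def eta (t : ℝ) : ℝ :=
  ((4 / Real.pi) * t + (4 / Real.pi) * Real.cos t * Real.sin t - 2 * Real.sin t) / Real.cos t ^ 2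

theorem tendsto_sub_sin_div_cube :
    Tendsto (fun s : ℝ => (s - sin s) / s ^ 3) (𝓝[≠] 0) (𝓝 (1 / 6)) := by
  rw [tendsto_iff_norm_sub_tendsto_zero]
  have hlim : Tendsto (fun s : ℝ => |s| ^ 2 * (1 / 100)) (𝓝[≠] 0) (𝓝 0) := by
    have h : Continuous fun s : ℝ => |s| ^ 2 * (1 / 100) := by fun_prop
    simpa using (h.tendsto 0).mono_left nhdsWithin_le_nhds
  refine squeeze_zero' (Eventually.of_forall fun _ => norm_nonneg _) ?_ hlim
  filter_upwards [self_mem_nhdsWithin,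
    nhdsWithin_le_nhds (Metric.closedBall_mem_nhds (0 : ℝ) one_pos)] with s hs hs1
  have hs0 : s ≠ 0 := hs
  have hb := Real.sin_bound (x := s) (by simpa using hs1)
  have he : (s - sin s) / s ^ 3 - 1 / 6 = -(sin s - (s - s ^ 3 / 6)) / s ^ 3 := by
    field_simp
    ring
  rw [he, Real.norm_eq_abs, abs_div, abs_neg, abs_pow, div_le_iff₀ (by positivity)]
  linarith

theorem tendsto_one_sub_cos_div_sq :
    Tendsto (fun s : ℝ => (1 - cos s) / s ^ 2) (𝓝[≠] 0) (𝓝 (1 / 2)) := by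
  rw [tendsto_iff_norm_sub_tendsto_zero]
  have hlim : Tendsto (fun s : ℝ => |s| ^ 2 * (5 / 96)) (𝓝[≠] 0) (𝓝 0) := by
    have h : Continuous fun s : ℝ => |s| ^ 2 * (5 / 96) := by fun_prop
    simpa using (h.tendsto 0).mono_left nhdsWithin_le_nhds
  refine squeeze_zero' (Eventually.of_forall fun _ => norm_nonneg _) ?_ hlim
  filter_upwards [self_mem_nhdsWithin,
    nhdsWithin_le_nhds (Metric.closedBall_mem_nhds (0 : ℝ) one_pos)] with s hs hs1
  have hs0 : s ≠ 0 := hs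
  have hb := Real.cos_bound (x := s) (by simpa using hs1)
  have he : (1 - cos s) / s ^ 2 - 1 / 2 = -(cos s - (1 - s ^ 2 / 2)) / s ^ 2 := by
    field_simp
    ring
  rw [he, Real.norm_eq_abs, abs_div, abs_neg, abs_pow, div_le_iff₀ (by positivity)]
  linarith

theorem tendsto_div_sin : Tendsto (fun s : ℝ => s / sin s) (𝓝[≠] 0) (𝓝 1) := by
  have h := (hasDerivAt_sin 0).tendsto_slope_zero
  simp only [zero_add, sin_zero, sub_zero, cos_zero, smul_eq_mul] at h
  have h' := h.inv₀ one_ne_zero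
  simpa [div_eq_mul_inv, mul_comm] using h'

theorem eventually_sin_ne_zero : ∀ᶠ s : ℝ in 𝓝[≠] 0, sin s ≠ 0 := by
  filter_upwards [tendsto_div_sin.eventually_ne one_ne_zero] with s hs h
  simp [h] at hs

theorem xi_neg (t : ℝ) : xi (-t) = xi t := by
  simp [xi]

theorem deriv_xi_neg (t : ℝ) : deriv xi (-t) = -deriv xi t := by
  have h := deriv_comp_neg xi t
  simp only [xi_neg] at h
  have h' : deriv (fun x => xi x) t = deriv xi t := rfl
  linarith

theorem xi_pi_div_two_sub (s : ℝ) :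
    xi (π / 2 - s) =
      ((sin s - s) ^ 2 + 2 * s * sin s * (1 - cos s) + π * (sin s * cos s - s)) / sin s ^ 2 := by
  rw [xi, cos_pi_div_two_sub, sin_pi_div_two_sub]
  ring

theorem deriv_xi_pi_div_two_sub {s : ℝ} (hs : sin s ≠ 0) :
    deriv xi (π / 2 - s) =
      2 * (π * (sin s - s * cos s) + cos s * (sin s - s) ^ 2 - 2 * s * sin s * (1 - cos s)) /
        sin s ^ 3 := by
  have hc : cos (π / 2 - s) ≠ 0 := by rwa [cos_pi_div_two_sub]
  have hcos := hasDerivAt_cos (π / 2 - s)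
  have hsin := hasDerivAt_sin (π / 2 - s)
  have hid := hasDerivAt_id' (π / 2 - s)
  have h := ((((hcos.fun_pow 2).fun_add (((hid.const_mul 2).fun_mul hsin).fun_mul hcos)).fun_add
    (hid.fun_pow 2)).sub_const (π ^ 2 / 4)).fun_div (hcos.fun_pow 2) (pow_ne_zero 2 hc)
  have h' : deriv xi (π / 2 - s) = _ := h.deriv
  rw [h', cos_pi_div_two_sub, sin_pi_div_two_sub]
  field_simp
  have hsq : cos s ^ 2 = 1 - sin s ^ 2 := by rw [← sin_sq_add_cos_sq s]; ring
  simp only [Nat.cast_ofNat]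
  ring_nf
  simp only [hsq]
  ring

theorem tendsto_xi_pi_div_two_sub :
    Tendsto (fun s : ℝ => xi (π / 2 - s)) (𝓝[≠] 0) (𝓝 0) := by
  have hs : Tendsto (fun s : ℝ => s) (𝓝[≠] 0) (𝓝 0) := nhdsWithin_le_nhds
  have hsin : Tendsto sin (𝓝[≠] 0) (𝓝 0) := by
    simpa using (continuous_sin.tendsto 0).mono_left nhdsWithin_le_nhds
  have hcos : Tendsto cos (𝓝[≠] 0) (𝓝 1) := by
    simpa using (continuous_cos.tendsto 0).mono_left nhdsWithin_le_nhds
  have hA := tendsto_sub_sin_div_cube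
  have hB := tendsto_one_sub_cos_div_sq
  have h := (tendsto_div_sin.pow 2).mul ((((hs.pow 4).mul (hA.pow 2)).add
    (((hs.const_mul 2).mul hsin).mul hB)).sub ((hs.const_mul π).mul ((hA.mul hcos).add hB)))
  norm_num at h
  refine h.congr' ?_
  filter_upwards [eventually_sin_ne_zero, self_mem_nhdsWithin] with s hσ hs0
  have hs0 : s ≠ 0 := hs0
  rw [xi_pi_div_two_sub]
  field_simp
  ring

theorem tendsto_deriv_xi_pi_div_two_sub :
    Tendsto (fun s : ℝ => deriv xi (π / 2 - s)) (𝓝[≠] 0) (𝓝 (2 * π / 3)) := by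
  have hs : Tendsto (fun s : ℝ => s) (𝓝[≠] 0) (𝓝 0) := nhdsWithin_le_nhds
  have hsin : Tendsto sin (𝓝[≠] 0) (𝓝 0) := by
    simpa using (continuous_sin.tendsto 0).mono_left nhdsWithin_le_nhds
  have hcos : Tendsto cos (𝓝[≠] 0) (𝓝 1) := by
    simpa using (continuous_cos.tendsto 0).mono_left nhdsWithin_le_nhds
  have hA := tendsto_sub_sin_div_cube
  have hB := tendsto_one_sub_cos_div_sq
  have h := ((tendsto_div_sin.pow 3).const_mul 2).mul ((((hB.sub hA).const_mul π).add
    ((hcos.mul (hA.pow 2)).mul (hs.pow 3))).sub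
      ((hsin.const_mul 2).mul hB))
  have hval : 2 * 1 ^ 3 * (π * (1 / 2 - 1 / 6) + 1 * (1 / 6) ^ 2 * 0 ^ 3 - 2 * 0 * (1 / 2)) =
      2 * π / 3 := by ring
  rw [hval] at h
  refine h.congr' ?_
  filter_upwards [eventually_sin_ne_zero, self_mem_nhdsWithin] with s hσ hs0
  have hs0 : s ≠ 0 := hs0
  rw [deriv_xi_pi_div_two_sub hσ]
  field_simp
  ring

theorem xi_boundary_limits :
    Filter.Tendsto xi (nhdsWithin (Real.pi / 2) (Set.Iio (Real.pi / 2))) (nhds 0) ∧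
    Filter.Tendsto (deriv xi) (nhdsWithin (Real.pi / 2) (Set.Iio (Real.pi / 2)))
      (nhds (2 * Real.pi / 3)) ∧
    Filter.Tendsto xi (nhdsWithin (-(Real.pi / 2)) (Set.Ioi (-(Real.pi / 2)))) (nhds 0) ∧
    Filter.Tendsto (deriv xi) (nhdsWithin (-(Real.pi / 2)) (Set.Ioi (-(Real.pi / 2))))
      (nhds (-(2 * Real.pi / 3))) := by
  have hr : Tendsto (fun t : ℝ => π / 2 - t) (𝓝[<] (π / 2)) (𝓝[≠] 0) := by
    refine tendsto_nhdsWithin_iff.2 ⟨?_, ?_⟩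
    · have h : Continuous fun t : ℝ => π / 2 - t := by fun_prop
      simpa using (h.tendsto (π / 2)).mono_left nhdsWithin_le_nhds
    · filter_upwards [self_mem_nhdsWithin] with t ht
      exact (sub_pos.2 ht).ne'
  have hl : Tendsto (fun t : ℝ => π / 2 + t) (𝓝[>] (-(π / 2))) (𝓝[≠] 0) := by
    refine tendsto_nhdsWithin_iff.2 ⟨?_, ?_⟩
    · have h : Continuous fun t : ℝ => π / 2 + t := by fun_prop
      simpa using (h.tendsto (-(π / 2))).mono_left nhdsWithin_le_nhds
    · filter_upwards [self_mem_nhdsWithin] with t ht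
      exact (neg_lt_iff_pos_add'.1 ht).ne'
  refine ⟨?_, ?_, ?_, ?_⟩
  · simpa [Function.comp_def] using tendsto_xi_pi_div_two_sub.comp hr
  · simpa [Function.comp_def] using tendsto_deriv_xi_pi_div_two_sub.comp hr
  · simpa [Function.comp_def, xi_neg] using tendsto_xi_pi_div_two_sub.comp hl
  · simpa [Function.comp_def, deriv_xi_neg] using (tendsto_deriv_xi_pi_div_two_sub.comp hl).neg
end

section
/- The second derivative of ξ is strictly positive on (−π/2, π/2): ξ''(t) > 0 for all t in (−π/2, π/2); in particular ξ' is strictly increasing on (−π/2, π/2), and ξ''(0) = 2(3 − π²/4). -/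
open Real Set Filter Topology

/-- The first derivative of `xi`, in closed form. -/
theorem hasDerivAt_xi {t : ℝ} (ht : cos t ≠ 0) :
    HasDerivAt xi ((2 * sin t * cos t ^ 2 + 4 * t * cos t +
      2 * (t ^ 2 - π ^ 2 / 4) * sin t) / cos t ^ 3) t := by
  have hc := hasDerivAt_cos t
  have hs := hasDerivAt_sin t
  have hi := hasDerivAt_id' t
  have h := ((((hc.pow 2).add (((hi.const_mul 2).mul hs).mul hc)).add (hi.pow 2)).sub_const
    (π ^ 2 / 4)).div (hc.pow 2) (pow_ne_zero 2 ht)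
  refine (h.congr_deriv ?_).congr_of_eventuallyEq (Eventually.of_forall fun x => ?_)
  · simp only [Pi.add_apply, Pi.mul_apply, Pi.pow_apply]
    field_simp
    have := sin_sq t
    push_cast
    linear_combination (8 * t * cos t ^ 2) * this
  · simp [xi]

theorem hasDerivAt_deriv_xi {t : ℝ} (ht : cos t ≠ 0) :
    HasDerivAt (deriv xi) (2 * (3 * cos t ^ 2 + 6 * t * sin t * cos t -
      (π ^ 2 / 4 - t ^ 2) * (1 + 2 * sin t ^ 2)) / cos t ^ 4) t := by
  have hc := hasDerivAt_cos t
  have hs := hasDerivAt_sin t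
  have hi := hasDerivAt_id' t
  have h := ((((hs.const_mul 2).mul (hc.pow 2)).add ((hi.const_mul 4).mul hc)).add
    ((((hi.pow 2).sub_const (π ^ 2 / 4)).const_mul 2).mul hs)).div (hc.pow 3) (pow_ne_zero 3 ht)
  have hev : ∀ᶠ x in 𝓝 t, cos x ≠ 0 := continuous_cos.continuousAt.eventually_ne ht
  refine (h.congr_deriv ?_).congr_of_eventuallyEq (hev.mono fun x hx => ?_)
  · simp only [Pi.add_apply, Pi.mul_apply, Pi.pow_apply]
    field_simp
    have := sin_sq t
    push_cast
    linear_combination (8 * cos t ^ 4 + (8 * t ^ 2 - 2 * π ^ 2) * cos t ^ 2) * this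
  · rw [(hasDerivAt_xi hx).deriv]
    simp

/-- This function decreases to `0` as `t` increases to `π / 2`. -/
theorem strictAntiOn_ratio_add_sq :
    StrictAntiOn (fun t : ℝ => (3 * cos t ^ 2 + 6 * t * sin t * cos t) / (1 + 2 * sin t ^ 2) + t ^ 2)
      (Icc 0 (π / 2)) := by
  have hd : ∀ t : ℝ, 1 + 2 * sin t ^ 2 ≠ 0 := fun t => by positivity
  refine strictAntiOn_of_hasDerivWithinAt_neg
    (f' := fun t => 4 * cos t ^ 3 * (2 * t * cos t - 3 * sin t) / (1 + 2 * sin t ^ 2) ^ 2)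
    (convex_Icc _ _) ?_ ?_ ?_
  · exact Continuous.continuousOn (by fun_prop (disch := exact hd _))
  · intro t _
    have hc := hasDerivAt_cos t
    have hs := hasDerivAt_sin t
    have hi := hasDerivAt_id' t
    have h := ((((hc.pow 2).const_mul 3).add (((hi.const_mul 6).mul hs).mul hc)).div
      (((hs.pow 2).const_mul 2).const_add 1) (hd t)).add (hi.pow 2)
    refine (h.congr_deriv ?_).hasDerivWithinAt
    simp only [Pi.add_apply, Pi.mul_apply, Pi.pow_apply]
    have h2 := hd t
    have h3 : cos t ^ 2 = 1 - sin t ^ 2 := cos_sq' t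
    have h4 : cos t ^ 3 = cos t * (1 - sin t ^ 2) := by rw [← h3]; ring
    field_simp
    push_cast
    ring_nf
    have h5 : cos t ^ 4 = (1 - sin t ^ 2) ^ 2 := by rw [← h3]; ring
    simp only [h3, h4, h5]
    ring
  · intro t ht
    rw [interior_Icc] at ht
    have hcos : 0 < cos t := cos_pos_of_mem_Ioo ⟨by linarith [ht.1, pi_pos], ht.2⟩
    have hsin : 0 < sin t := sin_pos_of_pos_of_lt_pi ht.1 (by linarith [ht.2, pi_pos])
    have htan := lt_tan ht.1 ht.2
    rw [tan_eq_sin_div_cos, lt_div_iff₀ hcos] at htan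
    have : 2 * t * cos t - 3 * sin t < 0 := by linarith
    exact div_neg_of_neg_of_pos (mul_neg_of_pos_of_neg (by positivity) this) (by positivity)

theorem second_deriv_numerator_pos_of_nonneg {t : ℝ} (h0 : 0 ≤ t) (ht : t < π / 2) :
    0 < 3 * cos t ^ 2 + 6 * t * sin t * cos t - (π ^ 2 / 4 - t ^ 2) * (1 + 2 * sin t ^ 2) := by
  have h := strictAntiOn_ratio_add_sq ⟨h0, ht.le⟩ (right_mem_Icc.2 (h0.trans ht.le)) ht
  simp only [cos_pi_div_two, sin_pi_div_two] at h
  have hd : 0 < 1 + 2 * sin t ^ 2 := by positivity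
  have h' : π ^ 2 / 4 - t ^ 2 < (3 * cos t ^ 2 + 6 * t * sin t * cos t) / (1 + 2 * sin t ^ 2) := by
    linarith
  rw [lt_div_iff₀ hd] at h'
  linarith

theorem second_deriv_numerator_pos {t : ℝ} (ht : t ∈ Ioo (-(π / 2)) (π / 2)) :
    0 < 3 * cos t ^ 2 + 6 * t * sin t * cos t - (π ^ 2 / 4 - t ^ 2) * (1 + 2 * sin t ^ 2) := by
  rcases le_total 0 t with h | h
  · exact second_deriv_numerator_pos_of_nonneg h ht.2
  · simpa using second_deriv_numerator_pos_of_nonneg (neg_nonneg.2 h) (neg_lt.1 ht.1)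

theorem xi_second_deriv_pos :
    (∀ t ∈ Set.Ioo (-(Real.pi / 2)) (Real.pi / 2), 0 < deriv (deriv xi) t) ∧
    StrictMonoOn (deriv xi) (Set.Ioo (-(Real.pi / 2)) (Real.pi / 2)) ∧
    deriv (deriv xi) 0 = 2 * (3 - Real.pi ^ 2 / 4) := by
  have hpos : ∀ t ∈ Ioo (-(π / 2)) (π / 2), 0 < deriv (deriv xi) t := fun t ht => by
    have hcos := cos_pos_of_mem_Ioo ht
    have hnum := second_deriv_numerator_pos ht
    rw [(hasDerivAt_deriv_xi hcos.ne').deriv]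
    positivity
  refine ⟨hpos, strictMonoOn_of_deriv_pos (convex_Ioo _ _) (fun t ht => ?_) fun t ht => ?_, ?_⟩
  · exact (hasDerivAt_deriv_xi (cos_pos_of_mem_Ioo ht).ne').continuousAt.continuousWithinAt
  · exact hpos t (interior_subset ht)
  · rw [(hasDerivAt_deriv_xi (by simp)).deriv]
    simp
end

section
/- The derivative of η satisfies 0 < 2(4/π − 1) = η'(0) ≤ η'(t) ≤ 8/(3π) for all t in (−π/2, π/2); in particular η is strictly increasing, and η'(t) tends to 8/(3π) as t tends to either endpoint ±π/2. -/
open Real Set Filter Topology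

theorem hasDerivAt_eta {t : ℝ} (ht : cos t ≠ 0) :
    HasDerivAt eta ((8 / π * (cos t + t * sin t) - 4 + 2 * cos t ^ 2) / cos t ^ 3) t := by
  have hs := hasDerivAt_sin t
  have hc := hasDerivAt_cos t
  have h := ((((hasDerivAt_id t).const_mul (4 / π)).add
    ((hc.const_mul (4 / π)).mul hs)).sub (hs.const_mul 2)).div (hc.pow 2) (pow_ne_zero 2 ht)
  refine h.congr_deriv ?_
  have hsq : sin t ^ 2 = 1 - cos t ^ 2 := sin_sq t
  simp only [Pi.add_apply, Pi.sub_apply, Pi.mul_apply, Pi.pow_apply, id_eq]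
  field_simp
  push_cast
  ring_nf
  simp only [hsq]
  ring

theorem deriv_eta {t : ℝ} (ht : t ∈ Ioo (-(π / 2)) (π / 2)) :
    deriv eta t = (8 / π * (cos t + t * sin t) - 4 + 2 * cos t ^ 2) / cos t ^ 3 :=
  (hasDerivAt_eta (cos_pos_of_mem_Ioo ht).ne').deriv

theorem deriv_eta_neg {t : ℝ} (ht : t ∈ Ioo (-(π / 2)) (π / 2)) :
    deriv eta (-t) = deriv eta t := by
  rw [deriv_eta ht, deriv_eta ⟨by linarith [ht.2], by linarith [ht.1]⟩]
  simp

theorem half_lt_eight_div_pi_sub_two : 1 / 2 < 8 / π - 2 := by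
  have : 5 / 2 < 8 / π := by
    rw [lt_div_iff₀ pi_pos]; linarith [pi_lt_d2]
  linarith

theorem eight_div_pi_sub_two_lt_one : 8 / π - 2 < 1 := by
  have : 8 / π < 3 := by
    rw [div_lt_iff₀ pi_pos]; linarith [pi_gt_three]
  linarith

/-- The derivative of the numerator of `deriv eta` minus `k * cos ^ 3`. -/
theorem hasDerivAt_num_sub (k t : ℝ) :
    HasDerivAt (fun t ↦ 8 / π * (cos t + t * sin t) - 4 + 2 * cos t ^ 2 - k * cos t ^ 3)
      (cos t * (8 / π * t - 4 * sin t + 3 * k * (cos t * sin t))) t := by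
  have hs := hasDerivAt_sin t
  have hc := hasDerivAt_cos t
  have h := ((((hc.add ((hasDerivAt_id t).mul hs)).const_mul (8 / π)).sub_const 4).add
    ((hc.pow 2).const_mul 2)).sub ((hc.pow 3).const_mul k)
  refine h.congr_deriv ?_
  simp only [id_eq]
  push_cast
  ring

theorem hasDerivAt_num_deriv_factor (k t : ℝ) :
    HasDerivAt (fun t ↦ 8 / π * t - 4 * sin t + 3 * k * (cos t * sin t))
      (8 / π - 4 * cos t + 3 * k * (2 * cos t ^ 2 - 1)) t := by
  have hs := hasDerivAt_sin t
  have hc := hasDerivAt_cos t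
  have h := (((hasDerivAt_id t).const_mul (8 / π)).sub (hs.const_mul 4)).add
    ((hc.mul hs).const_mul (3 * k))
  refine h.congr_deriv ?_
  linear_combination (-(3 * k)) * sin_sq t

theorem monotoneOn_Icc_of_hasDerivAt_nonneg {f f' : ℝ → ℝ} (hf : ∀ x, HasDerivAt f (f' x) x)
    {a b : ℝ} (h : ∀ x ∈ Icc a b, 0 ≤ f' x) : MonotoneOn f (Icc a b) :=
  monotoneOn_of_hasDerivWithinAt_nonneg (convex_Icc a b)
    (fun x _ ↦ (hf x).continuousAt.continuousWithinAt) (fun x _ ↦ (hf x).hasDerivWithinAt)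
    fun x hx ↦ h x (interior_subset hx)

theorem antitoneOn_Icc_of_hasDerivAt_nonpos {f f' : ℝ → ℝ} (hf : ∀ x, HasDerivAt f (f' x) x)
    {a b : ℝ} (h : ∀ x ∈ Icc a b, f' x ≤ 0) : AntitoneOn f (Icc a b) :=
  antitoneOn_of_hasDerivWithinAt_nonpos (convex_Icc a b)
    (fun x _ ↦ (hf x).continuousAt.continuousWithinAt) (fun x _ ↦ (hf x).hasDerivWithinAt)
    fun x hx ↦ h x (interior_subset hx)

theorem cos_nonneg_of_mem_Icc_zero {x : ℝ} (hx : x ∈ Icc 0 (π / 2)) : 0 ≤ cos x :=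
  cos_nonneg_of_mem_Icc ⟨by linarith [hx.1, pi_pos], hx.2⟩

theorem cos_le_cos_of_mem_Icc_zero {x y : ℝ} (hx : 0 ≤ x) (hxy : x ≤ y) (hy : y ≤ π / 2) :
    cos y ≤ cos x :=
  cos_le_cos_of_nonneg_of_le_pi hx (by linarith [pi_pos]) hxy

theorem num_le {t : ℝ} (ht : t ∈ Icc 0 (π / 2)) :
    8 / π * (cos t + t * sin t) - 4 + 2 * cos t ^ 2 ≤ 8 / (3 * π) * cos t ^ 3 := by
  have hq : ∀ x ∈ Icc 0 (π / 2),
      0 ≤ 8 / π * x - 4 * sin x + 3 * (8 / (3 * π)) * (cos x * sin x) := by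
    have hder := hasDerivAt_num_deriv_factor (8 / (3 * π))
    have hQ : ∀ x, 8 / π - 4 * cos x + 3 * (8 / (3 * π)) * (2 * cos x ^ 2 - 1) =
        16 / π * (cos x * (cos x - π / 4)) := by
      intro x
      field_simp
      ring
    have hπ0 : 0 ≤ π / 4 := by positivity
    have hπ1 : π / 4 ≤ 1 := by linarith [pi_le_four]
    set a := arccos (π / 4) with ha
    have ha0 : 0 ≤ a := arccos_nonneg _
    have ha1 : a ≤ π / 2 := arccos_le_pi_div_two.2 hπ0
    have hca : cos a = π / 4 := cos_arccos (by linarith) hπ1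
    intro x hx
    rcases le_total x a with hxa | hxa
    · have := monotoneOn_Icc_of_hasDerivAt_nonneg hder (a := 0) (b := a) (fun y hy ↦ by
        rw [hQ]
        have := cos_le_cos_of_mem_Icc_zero hy.1 hy.2 ha1
        have h1 : 0 ≤ cos y - π / 4 := by linarith
        have h2 : 0 ≤ cos y := by linarith
        positivity) ⟨le_rfl, ha0⟩ ⟨hx.1, hxa⟩ hx.1
      simpa using this
    · have := antitoneOn_Icc_of_hasDerivAt_nonpos hder (a := a) (b := π / 2) (fun y hy ↦ by
        rw [hQ]
        have := cos_le_cos_of_mem_Icc_zero ha0 hy.1 hy.2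
        have h2 := cos_nonneg_of_mem_Icc_zero ⟨ha0.trans hy.1, hy.2⟩
        exact mul_nonpos_of_nonneg_of_nonpos (by positivity)
          (mul_nonpos_of_nonneg_of_nonpos h2 (by linarith))) ⟨hxa, hx.2⟩ ⟨ha1, le_rfl⟩ hx.2
      refine le_trans (le_of_eq ?_) this
      simp only [cos_pi_div_two, sin_pi_div_two]
      field_simp
      norm_num
  have := monotoneOn_Icc_of_hasDerivAt_nonneg (hasDerivAt_num_sub (8 / (3 * π))) (a := 0)
    (b := π / 2) (fun y hy ↦ mul_nonneg (cos_nonneg_of_mem_Icc_zero hy) (hq y hy)) ht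
    ⟨by positivity, le_rfl⟩ ht.2
  have hend : 8 / π * (π / 2) = 4 := by field_simp; norm_num
  simp only [cos_pi_div_two, sin_pi_div_two] at this
  linarith

theorem le_num {t : ℝ} (ht : t ∈ Icc 0 (π / 2)) :
    (8 / π - 2) * cos t ^ 3 ≤ 8 / π * (cos t + t * sin t) - 4 + 2 * cos t ^ 2 := by
  have hm0 := half_lt_eight_div_pi_sub_two
  have hm1 := eight_div_pi_sub_two_lt_one
  have hend : 8 / π * (π / 2) = 4 := by field_simp; norm_num
  have hder := hasDerivAt_num_deriv_factor (8 / π - 2)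
  have hnum := hasDerivAt_num_sub (8 / π - 2)
  obtain ⟨u, v, hu0, huv, hv1, hQ⟩ : ∃ u v : ℝ, 0 ≤ u ∧ u ≤ v ∧ v ≤ 1 ∧ ∀ c : ℝ,
      8 / π - 4 * c + 3 * (8 / π - 2) * (2 * c ^ 2 - 1) =
        6 * (8 / π - 2) * ((c - u) * (c - v)) := by
    generalize hm : 8 / π - 2 = m at *
    have h8 : 8 / π = m + 2 := by linarith
    have hD0 : 0 ≤ 12 * m ^ 2 - 12 * m + 4 := by nlinarith [sq_nonneg (m - 1 / 2)]
    have hD1 := sq_sqrt hD0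
    have hs2 : √(12 * m ^ 2 - 12 * m + 4) ≤ 2 := sqrt_le_iff.2 ⟨by norm_num, by nlinarith⟩
    have hs6 : √(12 * m ^ 2 - 12 * m + 4) ≤ 6 * m - 2 :=
      sqrt_le_iff.2 ⟨by linarith, by nlinarith⟩
    have hs0 := sqrt_nonneg (12 * m ^ 2 - 12 * m + 4)
    generalize √(12 * m ^ 2 - 12 * m + 4) = s at *
    have hm6 : 0 < 6 * m := by linarith
    refine ⟨(2 - s) / (6 * m), (2 + s) / (6 * m), div_nonneg (by linarith) hm6.le, ?_, ?_, ?_⟩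
    · gcongr; linarith
    · rw [div_le_one hm6]; linarith
    · intro c
      rw [h8]
      have : m ≠ 0 := by linarith
      field_simp
      linear_combination hD1
  set a := arccos v with ha
  set b := arccos u with hb
  have ha0 : 0 ≤ a := arccos_nonneg _
  have hab : a ≤ b := arccos_le_arccos huv
  have hb1 : b ≤ π / 2 := arccos_le_pi_div_two.2 hu0
  have hca : cos a = v := cos_arccos (by linarith) hv1
  have hcb : cos b = u := cos_arccos (by linarith) (by linarith)
  have hm6 : 0 ≤ 6 * (8 / π - 2) := by linarith
  have hleft : ∀ x ∈ Icc 0 a,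
      0 ≤ 8 / π * x - 4 * sin x + 3 * (8 / π - 2) * (cos x * sin x) := by
    intro x hx
    have := monotoneOn_Icc_of_hasDerivAt_nonneg hder (a := 0) (b := a) (fun y hy ↦ by
      rw [hQ]
      have := cos_le_cos_of_mem_Icc_zero hy.1 hy.2 (hab.trans hb1)
      exact mul_nonneg hm6 (mul_nonneg (by linarith) (by linarith))) ⟨le_rfl, ha0⟩ hx hx.1
    simpa using this
  have hright : ∀ x ∈ Icc b (π / 2),
      8 / π * x - 4 * sin x + 3 * (8 / π - 2) * (cos x * sin x) ≤ 0 := by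
    intro x hx
    have := monotoneOn_Icc_of_hasDerivAt_nonneg hder (a := b) (b := π / 2) (fun y hy ↦ by
      rw [hQ]
      have := cos_le_cos_of_mem_Icc_zero (ha0.trans hab) hy.1 hy.2
      exact mul_nonneg hm6 (mul_nonneg_of_nonpos_of_nonpos (by linarith) (by linarith)))
      hx ⟨hb1, le_rfl⟩ hx.2
    simp only [cos_pi_div_two, sin_pi_div_two] at this
    linarith
  have hmid := antitoneOn_Icc_of_hasDerivAt_nonpos hder (a := a) (b := b) (fun y hy ↦ by
    rw [hQ]
    have h1 := cos_le_cos_of_mem_Icc_zero (ha0.trans hy.1) hy.2 hb1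
    have h2 := cos_le_cos_of_mem_Icc_zero ha0 hy.1 (hy.2.trans hb1)
    exact mul_nonpos_of_nonneg_of_nonpos hm6
      (mul_nonpos_of_nonneg_of_nonpos (by linarith) (by linarith)))
  have hsign : (∀ x ∈ Icc 0 t,
        0 ≤ 8 / π * x - 4 * sin x + 3 * (8 / π - 2) * (cos x * sin x)) ∨
      ∀ x ∈ Icc t (π / 2),
        8 / π * x - 4 * sin x + 3 * (8 / π - 2) * (cos x * sin x) ≤ 0 := by
    rcases le_total t a with hta | hta
    · exact .inl fun x hx ↦ hleft x ⟨hx.1, hx.2.trans hta⟩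
    rcases le_total b t with hbt | hbt
    · exact .inr fun x hx ↦ hright x ⟨hbt.trans hx.1, hx.2⟩
    rcases le_total 0 (8 / π * t - 4 * sin t + 3 * (8 / π - 2) * (cos t * sin t)) with h | h
    · refine .inl fun x hx ↦ ?_
      rcases le_total x a with hxa | hxa
      · exact hleft x ⟨hx.1, hxa⟩
      · exact h.trans (hmid ⟨hxa, hx.2.trans hbt⟩ ⟨hta, hbt⟩ hx.2)
    · refine .inr fun x hx ↦ ?_
      rcases le_total b x with hbx | hbx
      · exact hright x ⟨hbx, hx.2⟩
      · exact (hmid ⟨hta, hbt⟩ ⟨hta.trans hx.1, hbx⟩ hx.1).trans h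
  rcases hsign with h | h
  · have := monotoneOn_Icc_of_hasDerivAt_nonneg hnum (a := 0) (b := t) (fun y hy ↦
      mul_nonneg (cos_nonneg_of_mem_Icc_zero ⟨hy.1, hy.2.trans ht.2⟩) (h y hy))
      ⟨le_rfl, ht.1⟩ ⟨ht.1, le_rfl⟩ ht.1
    simp only [cos_zero, sin_zero] at this
    linarith
  · have := antitoneOn_Icc_of_hasDerivAt_nonpos hnum (a := t) (b := π / 2) (fun y hy ↦
      mul_nonpos_of_nonneg_of_nonpos (cos_nonneg_of_mem_Icc_zero ⟨ht.1.trans hy.1, hy.2⟩)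
        (h y hy)) ⟨le_rfl, ht.2⟩ ⟨ht.2, le_rfl⟩ ht.2
    simp only [cos_pi_div_two, sin_pi_div_two] at this
    linarith

theorem deriv_eta_mem_Icc_of_nonneg {t : ℝ} (ht0 : 0 ≤ t) (ht1 : t < π / 2) :
    deriv eta t ∈ Icc (8 / π - 2) (8 / (3 * π)) := by
  have hmem : t ∈ Ioo (-(π / 2)) (π / 2) := ⟨by linarith [pi_pos], ht1⟩
  have hc : 0 < cos t ^ 3 := pow_pos (cos_pos_of_mem_Ioo hmem) 3
  rw [deriv_eta hmem]
  exact ⟨(le_div_iff₀ hc).2 (le_num ⟨ht0, ht1.le⟩), (div_le_iff₀ hc).2 (num_le ⟨ht0, ht1.le⟩)⟩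

theorem deriv_eta_mem_Icc {t : ℝ} (ht : t ∈ Ioo (-(π / 2)) (π / 2)) :
    deriv eta t ∈ Icc (8 / π - 2) (8 / (3 * π)) := by
  rcases le_total 0 t with h | h
  · exact deriv_eta_mem_Icc_of_nonneg h ht.2
  · rw [← deriv_eta_neg ht]
    exact deriv_eta_mem_Icc_of_nonneg (by linarith) (by linarith [ht.1])

theorem tendsto_nhdsLT_of_continuous {f : ℝ → ℝ} (hf : Continuous f) {a l : ℝ} (h : f a = l) :
    Tendsto f (𝓝[<] a) (𝓝 l) :=
  h ▸ hf.continuousAt.tendsto.mono_left nhdsWithin_le_nhds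

theorem tendsto_deriv_eta_nhdsLT :
    Tendsto (deriv eta) (𝓝[<] (π / 2)) (𝓝 (8 / (3 * π))) := by
  have hend : 8 / π * (π / 2) = 4 := by field_simp; norm_num
  have hpos : (0 : ℝ) < π / 2 := by positivity
  have hcos : ∀ x ∈ Ioo 0 (π / 2), 0 < cos x := fun x hx ↦
    cos_pos_of_mem_Ioo ⟨by linarith [hx.1], hx.2⟩
  have hsin : ∀ x ∈ Ioo 0 (π / 2), 0 < sin x := fun x hx ↦
    sin_pos_of_pos_of_lt_pi hx.1 (by linarith [hx.2])
  have hinner : Tendsto (fun x ↦ (8 / π * x - 4 * sin x) / cos x) (𝓝[<] (π / 2))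
      (𝓝 (-(8 / π))) := by
    refine HasDerivAt.lhopital_zero_left_on_Ioo hpos (f' := fun x ↦ 8 / π - 4 * cos x)
      (g' := fun x ↦ -sin x) (fun x _ ↦ ?_) (fun x _ ↦ hasDerivAt_cos x)
      (fun x hx ↦ neg_ne_zero.2 (hsin x hx).ne') ?_ ?_ ?_
    · simpa using hasDerivAt_num_deriv_factor 0 x
    · exact tendsto_nhdsLT_of_continuous (by fun_prop) (by simp [hend])
    · exact tendsto_nhdsLT_of_continuous (by fun_prop) (by simp)
    · have h1 : Tendsto (fun x ↦ 8 / π - 4 * cos x) (𝓝[<] (π / 2)) (𝓝 (8 / π)) :=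
        tendsto_nhdsLT_of_continuous (by fun_prop) (by simp)
      have h2 : Tendsto (fun x ↦ -sin x) (𝓝[<] (π / 2)) (𝓝 (-1)) :=
        tendsto_nhdsLT_of_continuous (by fun_prop) (by simp)
      have h3 := h1.div h2 (by norm_num)
      rwa [div_neg, div_one] at h3
  have hmain : Tendsto (fun x ↦ (8 / π * (cos x + x * sin x) - 4 + 2 * cos x ^ 2) / cos x ^ 3)
      (𝓝[<] (π / 2)) (𝓝 (8 / (3 * π))) := by
    refine HasDerivAt.lhopital_zero_left_on_Ioo hpos
      (f' := fun x ↦ cos x * (8 / π * x - 4 * sin x))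
      (g' := fun x ↦ 3 * cos x ^ 2 * -sin x) (fun x _ ↦ ?_)
      (fun x _ ↦ (hasDerivAt_cos x).pow 3) (fun x hx ↦ ?_) ?_ ?_ ?_
    · simpa using hasDerivAt_num_sub 0 x
    · have := hcos x hx
      have := hsin x hx
      simp only [mul_neg, ne_eq, neg_eq_zero]
      positivity
    · exact tendsto_nhdsLT_of_continuous (by fun_prop) (by simp [hend])
    · exact tendsto_nhdsLT_of_continuous (by fun_prop) (by simp)
    · have h2 : Tendsto (fun x ↦ 3 * -sin x) (𝓝[<] (π / 2)) (𝓝 (-3)) :=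
        tendsto_nhdsLT_of_continuous (by fun_prop) (by simp)
      have h3 := hinner.div h2 (by norm_num)
      rw [show -(8 / π) / -3 = 8 / (3 * π) by field_simp] at h3
      refine h3.congr' ?_
      filter_upwards [Ioo_mem_nhdsLT hpos] with x hx
      have := (hcos x hx).ne'
      have := (hsin x hx).ne'
      simp only [Pi.div_apply]
      field_simp
  refine hmain.congr' ?_
  filter_upwards [Ioo_mem_nhdsLT hpos] with x hx
  exact (deriv_eta ⟨by linarith [hx.1], hx.2⟩).symm

theorem tendsto_deriv_eta_nhdsGT :
    Tendsto (deriv eta) (𝓝[>] (-(π / 2))) (𝓝 (8 / (3 * π))) := by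
  have hneg : Tendsto Neg.neg (𝓝[>] (-(π / 2))) (𝓝[<] (π / 2)) :=
    tendsto_neg_nhdsGT_neg
  refine (tendsto_deriv_eta_nhdsLT.comp hneg).congr' ?_
  filter_upwards [Ioo_mem_nhdsGT (show -(π / 2) < π / 2 by linarith [pi_pos])] with x hx
  exact deriv_eta_neg hx

theorem eta_deriv_bounds :
    0 < 2 * (4 / Real.pi - 1) ∧
    deriv eta 0 = 2 * (4 / Real.pi - 1) ∧
    (∀ t ∈ Set.Ioo (-(Real.pi / 2)) (Real.pi / 2),
      2 * (4 / Real.pi - 1) ≤ deriv eta t ∧ deriv eta t ≤ 8 / (3 * Real.pi)) ∧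
    StrictMonoOn eta (Set.Ioo (-(Real.pi / 2)) (Real.pi / 2)) ∧
    Filter.Tendsto (deriv eta) (nhdsWithin (Real.pi / 2) (Set.Iio (Real.pi / 2)))
      (nhds (8 / (3 * Real.pi))) ∧
    Filter.Tendsto (deriv eta) (nhdsWithin (-(Real.pi / 2)) (Set.Ioi (-(Real.pi / 2))))
      (nhds (8 / (3 * Real.pi))) := by
  have hm : 2 * (4 / π - 1) = 8 / π - 2 := by ring
  have hm0 := half_lt_eight_div_pi_sub_two
  rw [hm]
  refine ⟨by linarith, ?_, fun t ht ↦ deriv_eta_mem_Icc ht, ?_, tendsto_deriv_eta_nhdsLT,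
    tendsto_deriv_eta_nhdsGT⟩
  · rw [deriv_eta ⟨by linarith [pi_pos], by linarith [pi_pos]⟩]
    simp
    ring
  · refine strictMonoOn_of_deriv_pos (convex_Ioo _ _) (fun x hx ↦ ?_) fun x hx ↦ ?_
    · exact (hasDerivAt_eta (cos_pos_of_mem_Ioo hx).ne').continuousAt.continuousWithinAt
    · linarith [(deriv_eta_mem_Icc (interior_subset hx)).1]
end

section
/- For all t in (−π/2, 0], the function η satisfies the quadratic lower bound η(t) ≥ −(π²/16 − 1/3) + (8/(3π) − π/4)·t − (1/4)·t². -/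
open Real Set Filter Topology

lemma nonneg_of_hasDerivAt_nonneg {f f' : ℝ → ℝ} (hf : ∀ x, HasDerivAt f (f' x) x)
    (h0 : f 0 = 0) (hf' : ∀ x, 0 ≤ x → 0 ≤ f' x) {x : ℝ} (hx : 0 ≤ x) : 0 ≤ f x := by
  have hmono : MonotoneOn f (Set.Ici 0) := by
    refine monotoneOn_of_deriv_nonneg (convex_Ici 0)
      (fun y _ => (hf y).continuousAt.continuousWithinAt)
      (fun y _ => (hf y).differentiableAt.differentiableWithinAt) fun y hy => ?_
    rw [interior_Ici] at hy
    rw [(hf y).deriv]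
    exact hf' y hy.le
  simpa [h0] using hmono Set.self_mem_Ici hx hx

lemma taylor_three_le_sin {x : ℝ} (hx : 0 ≤ x) :
    x - x ^ 3 / 6 ≤ Real.sin x := by
  have hd (x : ℝ) : HasDerivAt (fun x : ℝ => Real.sin x - (x - x ^ 3 / 6))
      (Real.cos x - (1 - x ^ 2 / 2)) x := by
    refine HasDerivAt.congr_deriv ((Real.hasDerivAt_sin x).sub
        ((hasDerivAt_id x).sub
        ((hasDerivAt_pow 3 x).div_const 6))) ?_
    norm_num
    ring
  have h := nonneg_of_hasDerivAt_nonneg hd (by simp) (fun x hx => ?_) hx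
  · linarith
  · have := Real.one_sub_sq_div_two_le_cos (x := x)
    linarith

lemma cos_le_taylor_four {x : ℝ} (hx : 0 ≤ x) :
    Real.cos x ≤ 1 - x ^ 2 / 2 + x ^ 4 / 24 := by
  have hd (x : ℝ) : HasDerivAt (fun x : ℝ => 1 - x ^ 2 / 2 + x ^ 4 / 24 - Real.cos x)
      (Real.sin x - (x - x ^ 3 / 6)) x := by
    refine HasDerivAt.congr_deriv (((((hasDerivAt_const x (1 : ℝ)).sub
        ((hasDerivAt_pow 2 x).div_const 2)).add
        ((hasDerivAt_pow 4 x).div_const 24))).sub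
        (Real.hasDerivAt_cos x)) ?_
    norm_num
    ring
  have h := nonneg_of_hasDerivAt_nonneg hd (by simp) (fun x hx => ?_) hx
  · linarith
  · have := taylor_three_le_sin hx
    linarith

lemma sin_le_taylor_five {x : ℝ} (hx : 0 ≤ x) :
    Real.sin x ≤ x - x ^ 3 / 6 + x ^ 5 / 120 := by
  have hd (x : ℝ) : HasDerivAt (fun x : ℝ => x - x ^ 3 / 6 + x ^ 5 / 120 - Real.sin x)
      ((1 - x ^ 2 / 2 + x ^ 4 / 24) - Real.cos x) x := by
    refine HasDerivAt.congr_deriv (((((hasDerivAt_id x).sub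
        ((hasDerivAt_pow 3 x).div_const 6)).add
        ((hasDerivAt_pow 5 x).div_const 120))).sub
        (Real.hasDerivAt_sin x)) ?_
    norm_num
    ring
  have h := nonneg_of_hasDerivAt_nonneg hd (by simp) (fun x hx => ?_) hx
  · linarith
  · have := cos_le_taylor_four hx
    linarith

lemma taylor_six_le_cos {x : ℝ} (hx : 0 ≤ x) :
    1 - x ^ 2 / 2 + x ^ 4 / 24 - x ^ 6 / 720 ≤ Real.cos x := by
  have hd (x : ℝ) : HasDerivAt (fun x : ℝ =>
        Real.cos x - (1 - x ^ 2 / 2 + x ^ 4 / 24 - x ^ 6 / 720))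
      ((x - x ^ 3 / 6 + x ^ 5 / 120) - Real.sin x) x := by
    refine HasDerivAt.congr_deriv ((Real.hasDerivAt_cos x).sub
        ((((hasDerivAt_const x (1 : ℝ)).sub
        ((hasDerivAt_pow 2 x).div_const 2)).add
        ((hasDerivAt_pow 4 x).div_const 24)).sub
        ((hasDerivAt_pow 6 x).div_const 720))) ?_
    norm_num
    ring
  have h := nonneg_of_hasDerivAt_nonneg hd (by simp) (fun x hx => ?_) hx
  · linarith
  · have := sin_le_taylor_five hx
    linarith

lemma taylor_seven_le_sin {x : ℝ} (hx : 0 ≤ x) :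
    x - x ^ 3 / 6 + x ^ 5 / 120 - x ^ 7 / 5040 ≤ Real.sin x := by
  have hd (x : ℝ) : HasDerivAt (fun x : ℝ =>
        Real.sin x - (x - x ^ 3 / 6 + x ^ 5 / 120 - x ^ 7 / 5040))
      (Real.cos x - (1 - x ^ 2 / 2 + x ^ 4 / 24 - x ^ 6 / 720)) x := by
    refine HasDerivAt.congr_deriv ((Real.hasDerivAt_sin x).sub
        ((((hasDerivAt_id x).sub
        ((hasDerivAt_pow 3 x).div_const 6)).add
        ((hasDerivAt_pow 5 x).div_const 120)).sub
        ((hasDerivAt_pow 7 x).div_const 5040))) ?_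
    norm_num
    ring
  have h := nonneg_of_hasDerivAt_nonneg hd (by simp) (fun x hx => ?_) hx
  · linarith
  · have := taylor_six_le_cos hx
    linarith

lemma cos_le_taylor_eight {x : ℝ} (hx : 0 ≤ x) :
    Real.cos x ≤ 1 - x ^ 2 / 2 + x ^ 4 / 24 - x ^ 6 / 720 + x ^ 8 / 40320 := by
  have hd (x : ℝ) : HasDerivAt (fun x : ℝ =>
        1 - x ^ 2 / 2 + x ^ 4 / 24 - x ^ 6 / 720 + x ^ 8 / 40320 - Real.cos x)
      (Real.sin x - (x - x ^ 3 / 6 + x ^ 5 / 120 - x ^ 7 / 5040)) x := by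
    refine HasDerivAt.congr_deriv (((((((hasDerivAt_const x (1 : ℝ)).sub
        ((hasDerivAt_pow 2 x).div_const 2)).add
        ((hasDerivAt_pow 4 x).div_const 24)).sub
        ((hasDerivAt_pow 6 x).div_const 720)).add
        ((hasDerivAt_pow 8 x).div_const 40320))).sub
        (Real.hasDerivAt_cos x)) ?_
    norm_num
    ring
  have h := nonneg_of_hasDerivAt_nonneg hd (by simp) (fun x hx => ?_) hx
  · linarith
  · have := taylor_seven_le_sin hx
    linarith

lemma sin_le_taylor_nine {x : ℝ} (hx : 0 ≤ x) :
    Real.sin x ≤ x - x ^ 3 / 6 + x ^ 5 / 120 - x ^ 7 / 5040 + x ^ 9 / 362880 := by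
  have hd (x : ℝ) : HasDerivAt (fun x : ℝ =>
        x - x ^ 3 / 6 + x ^ 5 / 120 - x ^ 7 / 5040 + x ^ 9 / 362880 - Real.sin x)
      ((1 - x ^ 2 / 2 + x ^ 4 / 24 - x ^ 6 / 720 + x ^ 8 / 40320) - Real.cos x) x := by
    refine HasDerivAt.congr_deriv (((((((hasDerivAt_id x).sub
        ((hasDerivAt_pow 3 x).div_const 6)).add
        ((hasDerivAt_pow 5 x).div_const 120)).sub
        ((hasDerivAt_pow 7 x).div_const 5040)).add
        ((hasDerivAt_pow 9 x).div_const 362880))).sub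
        (Real.hasDerivAt_sin x)) ?_
    norm_num
    ring
  have h := nonneg_of_hasDerivAt_nonneg hd (by simp) (fun x hx => ?_) hx
  · linarith
  · have := cos_le_taylor_eight hx
    linarith

lemma two_le_one_add_cos_mul {u : ℝ} (h0 : 0 ≤ u) (h1 : u ≤ Real.pi / 2) :
    2 ≤ (1 + Real.cos u) * (1 + u ^ 2 / 4 + 8 / 125 * u ^ 4) := by
  have hc := taylor_six_le_cos h0
  have hv : u ^ 2 ≤ 2.4675 := by nlinarith [Real.pi_lt_d6]
  have hv0 : 0 ≤ u ^ 2 := sq_nonneg u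
  have hpoly : 2 ≤ (1 + (1 - u ^ 2 / 2 + u ^ 4 / 24 - u ^ 6 / 720)) *
      (1 + u ^ 2 / 4 + 8 / 125 * u ^ 4) := by
    have hcubic : 0 ≤ (1 / 24 - 1 / 8 + 16 / 125) + (-1 / 720 + 1 / 96 - 4 / 125) * u ^ 2
        + (-1 / 2880 + 1 / 375) * (u ^ 2) ^ 2 - 1 / 11250 * (u ^ 2) ^ 3 := by
      generalize u ^ 2 = v at *
      nlinarith [mul_nonneg hv0 (sub_nonneg.2 hv), mul_nonneg (sq_nonneg v) (sub_nonneg.2 hv)]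
    nlinarith [mul_nonneg (sq_nonneg (u ^ 2)) hcubic]
  refine hpoly.trans ?_
  gcongr

lemma mul_one_sub_cos_le_sub_sin {w : ℝ} (h0 : 0 ≤ w) (h1 : w ≤ Real.pi) :
    (w / 3 + w ^ 3 / 100) * (1 - Real.cos w) ≤ w - Real.sin w := by
  have hc := taylor_six_le_cos h0
  have hs := sin_le_taylor_nine h0
  have hz : w ^ 2 ≤ 9.87 := by nlinarith [Real.pi_lt_d6]
  have hz0 : 0 ≤ w ^ 2 := sq_nonneg w
  have hquad : 0 ≤ (-1 / 120 + 1 / 72 - 1 / 200) + (1 / 5040 - 1 / 2160 + 1 / 2400) * w ^ 2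
      - (1 / 362880 + 1 / 72000) * (w ^ 2) ^ 2 := by
    generalize w ^ 2 = z at *
    nlinarith [mul_nonneg hz0 (sub_nonneg.2 hz)]
  have hpoly : (w / 3 + w ^ 3 / 100) * (w ^ 2 / 2 - w ^ 4 / 24 + w ^ 6 / 720) ≤
      w ^ 3 / 6 - w ^ 5 / 120 + w ^ 7 / 5040 - w ^ 9 / 362880 := by
    nlinarith [mul_nonneg (pow_nonneg h0 5) hquad]
  calc (w / 3 + w ^ 3 / 100) * (1 - Real.cos w)
      ≤ (w / 3 + w ^ 3 / 100) * (w ^ 2 / 2 - w ^ 4 / 24 + w ^ 6 / 720) := by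
        gcongr
        linarith
    _ ≤ w - Real.sin w := by linarith

lemma mul_sin_sq_le_sub_sin_mul_cos {u : ℝ} (h0 : 0 ≤ u) (h1 : u ≤ Real.pi / 2) :
    (2 / 3 * u + 2 / 25 * u ^ 3) * Real.sin u ^ 2 ≤ u - Real.sin u * Real.cos u := by
  have h := mul_one_sub_cos_le_sub_sin (w := 2 * u) (by linarith) (by linarith)
  rw [Real.cos_two_mul, Real.sin_two_mul] at h
  rw [Real.sin_sq]
  linarith

lemma two_mul_one_sub_cos_sub_le {u : ℝ} (h0 : 0 ≤ u) (h1 : u ≤ Real.pi / 2) :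
    2 * (1 - Real.cos u) - 4 / Real.pi * (u - Real.sin u * Real.cos u) ≤
      (1 - 8 / (3 * Real.pi) * u + u ^ 2 / 4) * Real.sin u ^ 2 := by
  have hpi := Real.pi_pos
  have hcos : 2 * (1 - Real.cos u) ≤ (1 + u ^ 2 / 4 + 8 / 125 * u ^ 4) * Real.sin u ^ 2 := by
    have h := mul_le_mul_of_nonneg_right (two_le_one_add_cos_mul h0 h1)
      (sub_nonneg.2 (Real.cos_le_one u))
    rw [Real.sin_sq]
    linarith
  have hsin := mul_le_mul_of_nonneg_left (mul_sin_sq_le_sub_sin_mul_cos h0 h1)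
    (by positivity : 0 ≤ 4 / Real.pi)
  have hu : 8 / 125 * u ≤ 4 / Real.pi * (2 / 25) := by
    rw [div_mul_eq_mul_div (4 : ℝ), le_div_iff₀ hpi]
    nlinarith [Real.pi_lt_d6]
  have hquartic := mul_le_mul_of_nonneg_right hu
    (mul_nonneg (pow_nonneg h0 3) (sq_nonneg (Real.sin u)))
  have hcoef : 8 / (3 * Real.pi) = 4 / Real.pi * (2 / 3) := by
    field_simp
    norm_num
  rw [hcoef]
  linarith

theorem eta_quadratic_lower_bound :
    ∀ t ∈ Set.Ioc (-(Real.pi / 2)) (0 : ℝ),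
      eta t ≥ -(Real.pi ^ 2 / 16 - 1 / 3) + (8 / (3 * Real.pi) - Real.pi / 4) * t
        - (1 / 4) * t ^ 2 := by
  rintro t ⟨ht, ht0⟩
  have hpi := Real.pi_ne_zero
  have hcos : 0 < Real.cos t := Real.cos_pos_of_mem_Ioo ⟨ht, by linarith [Real.pi_pos]⟩
  have h := two_mul_one_sub_cos_sub_le (u := t + Real.pi / 2) (by linarith) (by linarith)
  rw [Real.cos_add_pi_div_two, Real.sin_add_pi_div_two] at h
  have hquad : -(Real.pi ^ 2 / 16 - 1 / 3) + (8 / (3 * Real.pi) - Real.pi / 4) * t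
      - (1 / 4) * t ^ 2 =
      -(1 - 8 / (3 * Real.pi) * (t + Real.pi / 2) + (t + Real.pi / 2) ^ 2 / 4) := by
    field_simp
    ring
  have hnum : 4 / Real.pi * t + 4 / Real.pi * Real.cos t * Real.sin t - 2 * Real.sin t =
      -(2 * (1 - -Real.sin t)
        - 4 / Real.pi * (t + Real.pi / 2 - Real.cos t * -Real.sin t)) := by
    field_simp
    ring
  rw [ge_iff_le, eta, le_div_iff₀ (pow_pos hcos 2), hquad, hnum]
  linarith
end
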